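/- (Transversality, first Melnikov.) There exist m₀ ∈ ℕ and ρ₀ > 0 such that for every κ ∈ [κ₁, κ₂], every ℓ ∈ ℤ^ν and every j ∈ S₀ᶜ satisfying the momentum condition j⃗·ℓ + j = 0: max over 0 ≤ n ≤ m₀ of |∂_κ^n ( Ω⃗(κ)·ℓ + Ω_j(κ) )| ≥ ρ₀·⟨ℓ⟩. -/

import Mathlib

open Real Finset Set

/-- `G_j := j · tanh(dpt · j)` (finite depth `dpt`). -/
noncomputable def Gfun (dpt : ℝ) (j : ℤ) : ℝ := (j : ℝ) * Real.tanh (dpt * (j : ℝ))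

/-- The linear frequencies `ω_j(κ)`. -/
noncomputable def omegaF (dpt g γ : ℝ) (j : ℤ) (κ : ℝ) : ℝ :=
  Real.sqrt (κ * Gfun dpt j * (j : ℝ) ^ 2 + g * Gfun dpt j + (γ * Gfun dpt j / (2 * (j : ℝ))) ^ 2)

/-- The linear frequencies `Ω_j(κ) = ω_j(κ) + (γ/2) G_j / j`. -/
noncomputable def OmegaF (dpt g γ : ℝ) (j : ℤ) (κ : ℝ) : ℝ :=
  omegaF dpt g γ j κ + γ / 2 * Gfun dpt j / (j : ℝ)

/-- If the moments `∑ wᵢ xᵢⁿ` are small, so is the pairing of `w` with a polynomial having prescribed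
roots among bounded nodes. -/
lemma abs_sum_mul_prod_sub_le {ι κ : Type*} [Fintype ι] (x : ι → ℝ) (y : κ → ℝ) {M ε : ℝ}
    (hM : 0 ≤ M) (hy : ∀ k, |y k| ≤ M) (s : Finset κ) (w : ι → ℝ)
    (h : ∀ n ≤ s.card, |∑ i, w i * x i ^ n| ≤ ε) :
    |∑ i, w i * ∏ k ∈ s, (x i - y k)| ≤ (1 + M) ^ s.card * ε := by
  classical
  induction s using Finset.induction_on generalizing w ε with
  | empty => simpa using h 0 le_rfl
  | insert b s hb ih =>
    rw [Finset.card_insert_of_notMem hb] at h ⊢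
    have key := ih (ε := (1 + M) * ε) (fun i => w i * (x i - y b)) (fun n hn => ?_)
    · simp only [Finset.prod_insert hb, ← mul_assoc]
      calc _ ≤ _ := key
        _ = _ := by ring
    · have e : ∑ i, w i * (x i - y b) * x i ^ n
          = ∑ i, w i * x i ^ (n + 1) - y b * ∑ i, w i * x i ^ n := by
        rw [Finset.mul_sum, ← Finset.sum_sub_distrib]
        exact Finset.sum_congr rfl fun i _ => by ring
      rw [e]
      have h1 := h (n + 1) (by omega)
      have h0 := h n (by omega)
      calc _ ≤ |∑ i, w i * x i ^ (n + 1)| + |y b * ∑ i, w i * x i ^ n| := abs_sub _ _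
        _ ≤ ε + M * ε := by
          rw [abs_mul]
          exact add_le_add h1 (mul_le_mul (hy b) h0 (abs_nonneg _) hM)
        _ = _ := by ring

/-- Quantitative Vandermonde bound: some moment of the weights `w` controls `w a`, provided the
node `x a` is `δ`-separated from the others. -/
lemma exists_le_abs_moment {ι : Type*} [Fintype ι] {N : ℕ}
    (hN : Fintype.card ι ≤ N + 1) (x w : ι → ℝ) {M δ : ℝ} (hM : 0 ≤ M) (hδ : 0 < δ) (hδ1 : δ ≤ 1)
    (hx : ∀ i, |x i| ≤ M) (a : ι) (hsep : ∀ i, i ≠ a → δ ≤ |x a - x i|) :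
    ∃ n ≤ N, |w a| * (δ / (1 + M)) ^ N ≤ |∑ i, w i * x i ^ n| := by
  classical
  by_contra! hcon
  have hcard : (Finset.univ.erase a).card ≤ N := by
    rw [Finset.card_erase_of_mem (Finset.mem_univ a), Finset.card_univ]
    omega
  set s := Finset.univ.erase a with hs
  have hw : 0 < |w a| := by
    by_contra! h0
    have h1 := hcon 0 (Nat.zero_le _)
    have h2 : |w a| = 0 := le_antisymm h0 (abs_nonneg _)
    rw [h2, zero_mul] at h1
    exact absurd h1 (abs_nonneg _).not_gt
  have hM1 : 0 < 1 + M := by linarith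
  obtain ⟨n₀, hn₀, hmax⟩ := Finset.exists_max_image (Finset.range (N + 1))
    (fun n => |∑ i, w i * x i ^ n|) ⟨0, by simp⟩
  have h1 := abs_sum_mul_prod_sub_le x x hM hx s w
    (fun n hn => hmax n (by simp only [Finset.mem_range]; omega))
  have hlt := hcon n₀ (by simp only [Finset.mem_range] at hn₀; omega)
  have hsum : ∑ i, w i * ∏ k ∈ s, (x i - x k) = w a * ∏ k ∈ s, (x a - x k) := by
    refine Finset.sum_eq_single a (fun i _ hi => ?_) (by simp)
    rw [Finset.prod_eq_zero (i := i) (by simp [hs, hi]) (sub_self _), mul_zero]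
  have hprod : δ ^ s.card ≤ |∏ k ∈ s, (x a - x k)| := by
    rw [Finset.abs_prod, ← Finset.prod_const]
    exact Finset.prod_le_prod (fun _ _ => hδ.le)
      fun k hk => hsep k (by simpa [hs] using hk)
  rw [hsum, abs_mul] at h1
  have h2 : (δ / (1 + M)) ^ N ≤ (δ / (1 + M)) ^ s.card :=
    pow_le_pow_of_le_one (by positivity) ((div_le_one hM1).2 (by linarith)) hcard
  have h3 : |w a| * δ ^ s.card < |w a| * δ ^ s.card := by
    calc |w a| * δ ^ s.card ≤ (1 + M) ^ s.card * |∑ i, w i * x i ^ n₀| :=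
          (mul_le_mul_of_nonneg_left hprod (abs_nonneg _)).trans h1
      _ < (1 + M) ^ s.card * (|w a| * (δ / (1 + M)) ^ N) := by gcongr
      _ ≤ (1 + M) ^ s.card * (|w a| * (δ / (1 + M)) ^ s.card) := by gcongr
      _ = |w a| * δ ^ s.card := by
        rw [div_pow]
        field_simp
  exact lt_irrefl _ h3

lemma tanh_pos_of_pos {x : ℝ} (hx : 0 < x) : 0 < Real.tanh x := by
  rw [Real.tanh_eq_sinh_div_cosh]
  exact div_pos (Real.sinh_pos_iff.2 hx) (Real.cosh_pos x)

lemma convexOn_sinh_Ici : ConvexOn ℝ (Set.Ici 0) Real.sinh := by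
  refine MonotoneOn.convexOn_of_deriv (convex_Ici 0) Real.continuous_sinh.continuousOn
    Real.differentiable_sinh.differentiableOn ?_
  rw [interior_Ici, Real.deriv_sinh]
  intro x hx y hy hxy
  rw [Real.cosh_le_cosh, abs_of_pos hx, abs_of_pos hy]
  exact hxy

/-- `tanh x / x` is nonincreasing on `(0, ∞)`. -/
lemma tanh_mul_le_tanh_mul {x y : ℝ} (hx : 0 < x) (hxy : x ≤ y) :
    Real.tanh y * x ≤ Real.tanh x * y := by
  have hq : 0 < x + y := by linarith
  have hc := convexOn_sinh_Ici.2 (Set.mem_Ici.2 le_rfl) (Set.mem_Ici.2 hq.le)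
    (sub_nonneg.2 ((div_le_one hq).2 (show y - x ≤ x + y by linarith)))
    (div_nonneg (sub_nonneg.2 hxy) hq.le) (sub_add_cancel _ _)
  have e : (1 - (y - x) / (x + y)) • (0 : ℝ) + ((y - x) / (x + y)) • (x + y) = y - x := by
    simp only [smul_eq_mul]
    field_simp
    ring
  rw [e] at hc
  simp only [smul_eq_mul, Real.sinh_zero, mul_zero, zero_add] at hc
  rw [div_mul_eq_mul_div, le_div_iff₀ hq, Real.sinh_sub, Real.sinh_add] at hc
  rw [Real.tanh_eq_sinh_div_cosh, Real.tanh_eq_sinh_div_cosh, div_mul_eq_mul_div,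
    div_mul_eq_mul_div, div_le_div_iff₀ (Real.cosh_pos _) (Real.cosh_pos _)]
  nlinarith

/-- The shift `c_j` in the factorization `ω_j(κ) = D_j (κ + c_j)^{1/2}`. -/
noncomputable def shiftF (dpt g γ : ℝ) (j : ℤ) : ℝ :=
  g / |(j : ℝ)| ^ 2 + γ ^ 2 / 4 * (Real.tanh (dpt * |(j : ℝ)|) / |(j : ℝ)| ^ 3)

/-- The amplitude `D_j` in the factorization `ω_j(κ) = D_j (κ + c_j)^{1/2}`. -/
noncomputable def ampF (dpt : ℝ) (j : ℤ) : ℝ :=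
  Real.sqrt (|(j : ℝ)| ^ 3 * Real.tanh (dpt * |(j : ℝ)|))

lemma one_le_abs_cast {j : ℤ} (hj : j ≠ 0) : (1 : ℝ) ≤ |(j : ℝ)| := by
  exact_mod_cast Int.one_le_abs hj

lemma tanh_mul_abs_pos {dpt : ℝ} (hdpt : 0 < dpt) {j : ℤ} (hj : j ≠ 0) :
    0 < Real.tanh (dpt * |(j : ℝ)|) :=
  tanh_pos_of_pos (mul_pos hdpt (by linarith [one_le_abs_cast hj]))

lemma Gfun_eq_abs (dpt : ℝ) (j : ℤ) :
    Gfun dpt j = |(j : ℝ)| * Real.tanh (dpt * |(j : ℝ)|) := by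
  rcases abs_choice (j : ℝ) with h | h <;> simp [Gfun, h, Real.tanh_neg]

lemma omegaF_eq_ampF_mul {dpt : ℝ} (hdpt : 0 < dpt) (g γ : ℝ) {j : ℤ} (hj : j ≠ 0) (κ : ℝ) :
    omegaF dpt g γ j κ = ampF dpt j * (κ + shiftF dpt g γ j) ^ (1 / 2 : ℝ) := by
  have hr : 0 < |(j : ℝ)| := by linarith [one_le_abs_cast hj]
  have ht := tanh_mul_abs_pos hdpt hj
  rw [omegaF, ampF, ← Real.sqrt_eq_rpow, ← Real.sqrt_mul (by positivity), div_pow, mul_pow 2,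
    ← sq_abs (j : ℝ), Gfun_eq_abs, shiftF]
  congr 1
  field_simp
  ring

lemma omegaF_neg (dpt g γ : ℝ) (j : ℤ) (κ : ℝ) :
    omegaF dpt g γ (-j) κ = omegaF dpt g γ j κ := by
  simp [omegaF, Gfun_eq_abs, div_neg]

lemma gravity_sub_le_shiftF_sub {dpt g γ : ℝ} (hdpt : 0 < dpt) {i j : ℤ}
    (hi : i ≠ 0) (h : |i| < |j|) :
    g / |(i : ℝ)| ^ 2 - g / |(j : ℝ)| ^ 2 ≤ shiftF dpt g γ i - shiftF dpt g γ j := by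
  have hr : 0 < |(i : ℝ)| := by linarith [one_le_abs_cast hi]
  have hij : |(i : ℝ)| ≤ |(j : ℝ)| := by exact_mod_cast h.le
  have hs : 0 < |(j : ℝ)| := hr.trans_le hij
  have ht := tanh_mul_abs_pos hdpt hi
  have h1 : Real.tanh (dpt * |(j : ℝ)|) / |(j : ℝ)| ^ 3
      ≤ Real.tanh (dpt * |(i : ℝ)|) / |(i : ℝ)| ^ 3 := by
    have h0 := tanh_mul_le_tanh_mul (mul_pos hdpt hr) (mul_le_mul_of_nonneg_left hij hdpt.le)
    have h0' : Real.tanh (dpt * |(j : ℝ)|) * |(i : ℝ)|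
        ≤ Real.tanh (dpt * |(i : ℝ)|) * |(j : ℝ)| :=
      le_of_mul_le_mul_left (by linarith) hdpt
    rw [div_le_div_iff₀ (by positivity) (by positivity)]
    calc _ = (Real.tanh (dpt * |(j : ℝ)|) * |(i : ℝ)|) * |(i : ℝ)| ^ 2 := by ring
      _ ≤ (Real.tanh (dpt * |(i : ℝ)|) * |(j : ℝ)|) * |(j : ℝ)| ^ 2 := by gcongr
      _ = _ := by ring
  have h2 := mul_le_mul_of_nonneg_left h1 (show 0 ≤ γ ^ 2 / 4 by positivity)
  unfold shiftF
  linarith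

lemma shiftF_separation {dpt g : ℝ} (hdpt : 0 < dpt) (hg : 0 < g) (γ : ℝ) {i j : ℤ}
    (hi : i ≠ 0) (hj : j ≠ 0) (h : |i| ≠ |j|) {B : ℝ} (hB : |(i : ℝ)| ≤ B) :
    g / (B ^ 2 * (B ^ 2 + 1)) ≤ |shiftF dpt g γ i - shiftF dpt g γ j| := by
  have hr := one_le_abs_cast hi
  have hs := one_le_abs_cast hj
  have hmono : g / (B ^ 2 * (B ^ 2 + 1)) ≤ g / (|(i : ℝ)| ^ 2 * (|(i : ℝ)| ^ 2 + 1)) := by gcongr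
  refine hmono.trans ?_
  rcases lt_or_gt_of_ne h with h | h
  · refine le_trans ?_ ((gravity_sub_le_shiftF_sub hdpt hi h).trans (le_abs_self _))
    have hij : |(i : ℝ)| + 1 ≤ |(j : ℝ)| := by exact_mod_cast h
    have h2 : |(i : ℝ)| ^ 2 + 1 ≤ |(j : ℝ)| ^ 2 := by nlinarith
    have h3 : g / |(j : ℝ)| ^ 2 ≤ g / (|(i : ℝ)| ^ 2 + 1) := by gcongr
    have h4 : g / (|(i : ℝ)| ^ 2 * (|(i : ℝ)| ^ 2 + 1))
        = g / |(i : ℝ)| ^ 2 - g / (|(i : ℝ)| ^ 2 + 1) := by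
      field_simp
      ring
    linarith
  · rw [abs_sub_comm]
    refine le_trans ?_ ((gravity_sub_le_shiftF_sub hdpt hj h).trans (le_abs_self _))
    have hij : |(j : ℝ)| + 1 ≤ |(i : ℝ)| := by exact_mod_cast h
    have h2 : |(j : ℝ)| ^ 2 + 1 ≤ |(i : ℝ)| ^ 2 := by nlinarith
    rw [div_sub_div _ _ (by positivity) (by positivity),
      div_le_div_iff₀ (by positivity) (by positivity)]
    set R := |(i : ℝ)| ^ 2
    set S := |(j : ℝ)| ^ 2
    have hS : 1 ≤ S := one_le_pow₀ hs
    calc g * (S * R) ≤ g * (1 * (R * (R + 1))) := by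
          refine mul_le_mul_of_nonneg_left ?_ hg.le
          nlinarith
      _ ≤ g * ((R - S) * (R * (R + 1))) := by
          gcongr
          linarith
      _ = _ := by ring

lemma shiftF_pos {dpt g : ℝ} (hdpt : 0 < dpt) (hg : 0 < g) (γ : ℝ) {j : ℤ} (hj : j ≠ 0) :
    0 < shiftF dpt g γ j := by
  have hr : 0 < |(j : ℝ)| := by linarith [one_le_abs_cast hj]
  have ht := tanh_mul_abs_pos hdpt hj
  unfold shiftF
  positivity

lemma shiftF_le {dpt g : ℝ} (hg : 0 < g) (γ : ℝ) {j : ℤ} (hj : j ≠ 0) :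
    shiftF dpt g γ j ≤ g + γ ^ 2 / 4 := by
  have hr := one_le_abs_cast hj
  have h1 : g / |(j : ℝ)| ^ 2 ≤ g := div_le_self hg.le (one_le_pow₀ hr)
  have h2 : Real.tanh (dpt * |(j : ℝ)|) / |(j : ℝ)| ^ 3 ≤ 1 :=
    (div_le_one (by positivity)).2 ((Real.tanh_lt_one _).le.trans (one_le_pow₀ hr))
  have h3 := mul_le_mul_of_nonneg_left h2 (show 0 ≤ γ ^ 2 / 4 by positivity)
  unfold shiftF
  linarith

lemma sqrt_tanh_le_ampF {dpt : ℝ} (hdpt : 0 < dpt) {j : ℤ} (hj : j ≠ 0) :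
    Real.sqrt (Real.tanh dpt) ≤ ampF dpt j := by
  have hr := one_le_abs_cast hj
  refine Real.sqrt_le_sqrt ?_
  have h0 : dpt ≤ dpt * |(j : ℝ)| := by nlinarith
  have h1 : Real.tanh dpt ≤ Real.tanh (dpt * |(j : ℝ)|) := by
    rw [Real.tanh_eq_sinh_div_cosh, Real.tanh_eq_sinh_div_cosh,
      div_le_div_iff₀ (Real.cosh_pos _) (Real.cosh_pos _)]
    have := Real.sinh_nonneg_iff.2 (sub_nonneg.2 h0)
    rw [Real.sinh_sub] at this
    linarith
  have h2 := tanh_mul_abs_pos hdpt hj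
  nlinarith [one_le_pow₀ (n := 3) hr]

lemma one_half_pow_le_abs_descPochhammer (n : ℕ) :
    (1 / 2 : ℝ) ^ n ≤ |(descPochhammer ℝ n).eval (1 / 2 : ℝ)| := by
  rw [descPochhammer_eval_eq_prod_range, Finset.abs_prod, ← Finset.card_range n,
    ← Finset.prod_const, Finset.card_range]
  refine Finset.prod_le_prod (fun _ _ => by norm_num) fun k _ => ?_
  rcases Nat.eq_zero_or_pos k with rfl | hk
  · norm_num
  · have : (1 : ℝ) ≤ k := by exact_mod_cast hk
    rw [abs_of_nonpos (by linarith)]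
    linarith

lemma iteratedDeriv_succ_OmegaF {dpt g : ℝ} (hdpt : 0 < dpt) (hg : 0 < g) (γ : ℝ) {j : ℤ}
    (hj : j ≠ 0) {κ : ℝ} (hκ : 0 < κ) (m : ℕ) :
    ContDiffAt ℝ (m + 1 : ℕ) (OmegaF dpt g γ j) κ ∧
    iteratedDeriv (m + 1) (OmegaF dpt g γ j) κ = (descPochhammer ℝ (m + 1)).eval (1 / 2 : ℝ) *
      (ampF dpt j * (κ + shiftF dpt g γ j) ^ (-(1 / 2) : ℝ) * (κ + shiftF dpt g γ j)⁻¹ ^ m) := by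
  have hpos : 0 < κ + shiftF dpt g γ j := add_pos hκ (shiftF_pos hdpt hg γ hj)
  have e : OmegaF dpt g γ j = fun κ' => γ / 2 * Gfun dpt j / (j : ℝ)
      + ampF dpt j * (fun t : ℝ => t ^ (1 / 2 : ℝ)) (κ' + shiftF dpt g γ j) := by
    funext κ'
    rw [OmegaF, omegaF_eq_ampF_mul hdpt g γ hj, add_comm]
  constructor
  · rw [e]
    have h1 : ContDiffAt ℝ (m + 1 : ℕ) (fun κ' : ℝ => (κ' + shiftF dpt g γ j) ^ (1 / 2 : ℝ)) κ :=
      (contDiffAt_id.add contDiffAt_const).rpow_const_of_ne hpos.ne'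
    exact contDiffAt_const.add (contDiffAt_const.mul h1)
  · rw [e, iteratedDeriv_const_add (Nat.succ_pos m), iteratedDeriv_const_mul_field,
      iteratedDeriv_comp_add_const (m + 1) (fun t : ℝ => t ^ (1 / 2 : ℝ)),
      iteratedDeriv_eq_iterate]
    beta_reduce
    rw [Real.iter_deriv_rpow_const]
    have h2 : (1 / 2 : ℝ) - ((m + 1 : ℕ) : ℝ) = -(1 / 2) - (m : ℝ) := by
      push_cast
      ring
    rw [h2, Real.rpow_sub hpos, Real.rpow_natCast, inv_pow]
    ring

lemma iteratedDeriv_succ_sum_OmegaF {ι : Type*} [Fintype ι] {dpt g : ℝ} (hdpt : 0 < dpt)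
    (hg : 0 < g) (γ C : ℝ) (J : ι → ℤ) (hJ : ∀ i, J i ≠ 0) (v : ι → ℝ) {κ : ℝ} (hκ : 0 < κ)
    (m : ℕ) :
    iteratedDeriv (m + 1) (fun κ' => C + ∑ i, v i * OmegaF dpt g γ (J i) κ') κ
      = (descPochhammer ℝ (m + 1)).eval (1 / 2 : ℝ) *
        ∑ i, v i * ampF dpt (J i) * (κ + shiftF dpt g γ (J i)) ^ (-(1 / 2) : ℝ)
          * (κ + shiftF dpt g γ (J i))⁻¹ ^ m := by
  rw [iteratedDeriv_const_add (Nat.succ_pos m), iteratedDeriv_fun_sum, Finset.mul_sum]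
  · refine Finset.sum_congr rfl fun i _ => ?_
    rw [iteratedDeriv_const_mul_field, (iteratedDeriv_succ_OmegaF hdpt hg γ (hJ i) hκ m).2]
    ring
  · exact fun i _ => contDiffAt_const.mul (iteratedDeriv_succ_OmegaF hdpt hg γ (hJ i) hκ m).1

/-- Some derivative of `C + ∑ vᵢ Ω_{Jᵢ}` of order at most `N + 1` controls `v a`, uniformly over
all sites with distinct absolute values and `|J a| ≤ B`. -/
lemma exists_transversality_const {dpt g κ₁ κ₂ : ℝ} (γ : ℝ) (hdpt : 0 < dpt) (hg : 0 < g)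
    (hκ₁ : 0 < κ₁) (hκ₁₂ : κ₁ < κ₂) (N : ℕ) {B : ℝ} (hB : 1 ≤ B) :
    ∃ ρ > (0 : ℝ), ∀ (ι : Type) [Fintype ι], Fintype.card ι ≤ N + 1 →
      ∀ (J : ι → ℤ) (v : ι → ℝ) (C : ℝ) (a : ι), (∀ i, J i ≠ 0) → |(J a : ℝ)| ≤ B →
      (∀ i, i ≠ a → |J a| ≠ |J i|) → ∀ κ ∈ Set.Icc κ₁ κ₂,
      ∃ n ≤ N + 1, ρ * |v a| ≤
        |iteratedDeriv n (fun κ' => C + ∑ i, v i * OmegaF dpt g γ (J i) κ') κ| := by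
  set K := κ₂ + (g + γ ^ 2 / 4) with hK
  have hKpos : 0 < K := by have := sq_nonneg γ; linarith
  set δ := min 1 (g / (B ^ 2 * (B ^ 2 + 1)) / K ^ 2)
  have hδ : 0 < δ := lt_min one_pos (by positivity)
  have hT : 0 < Real.sqrt (Real.tanh dpt) := Real.sqrt_pos.2 (tanh_pos_of_pos hdpt)
  refine ⟨(1 / 2) ^ (N + 1) * (Real.sqrt (Real.tanh dpt) * K ^ (-(1 / 2) : ℝ)
    * (δ / (1 + κ₁⁻¹)) ^ N), by positivity, ?_⟩
  intro ι _ hcard J v C a hJ hJa hsep κ hκ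
  have hκpos : 0 < κ := hκ₁.trans_le hκ.1
  have hp : ∀ i, 0 < shiftF dpt g γ (J i) := fun i => shiftF_pos hdpt hg γ (hJ i)
  have hpos : ∀ i, 0 < κ + shiftF dpt g γ (J i) := fun i => add_pos hκpos (hp i)
  have hle : ∀ i, κ + shiftF dpt g γ (J i) ≤ K := fun i =>
    add_le_add hκ.2 (shiftF_le hg γ (hJ i))
  obtain ⟨n, hn, hbound⟩ := exists_le_abs_moment hcard
    (fun i => (κ + shiftF dpt g γ (J i))⁻¹)
    (fun i => v i * ampF dpt (J i) * (κ + shiftF dpt g γ (J i)) ^ (-(1 / 2) : ℝ))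
    (M := κ₁⁻¹) (by positivity) hδ (min_le_left _ _)
    (fun i => by
      rw [abs_of_pos (inv_pos.2 (hpos i))]
      exact inv_anti₀ hκ₁ (by linarith [hκ.1, hp i])) a
    (fun i hi => by
      refine (min_le_right _ _).trans ?_
      have h1 := shiftF_separation hdpt hg γ (hJ a) (hJ i) (hsep i hi) hJa
      rw [inv_sub_inv (hpos a).ne' (hpos i).ne', abs_div,
        abs_of_pos (mul_pos (hpos a) (hpos i)), add_sub_add_left_eq_sub,
        abs_sub_comm (shiftF dpt g γ (J i))]
      have h2 : (κ + shiftF dpt g γ (J a)) * (κ + shiftF dpt g γ (J i)) ≤ K ^ 2 := by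
        rw [sq]
        exact mul_le_mul (hle a) (hle i) (hpos i).le hKpos.le
      exact div_le_div₀ (abs_nonneg _) h1 (mul_pos (hpos a) (hpos i)) h2)
  refine ⟨n + 1, by omega, ?_⟩
  rw [iteratedDeriv_succ_sum_OmegaF hdpt hg γ C J hJ v hκpos n, abs_mul]
  have hb : (1 / 2 : ℝ) ^ (N + 1) ≤ |(descPochhammer ℝ (n + 1)).eval (1 / 2 : ℝ)| :=
    (pow_le_pow_of_le_one (by norm_num) (by norm_num) (by omega)).trans
      (one_half_pow_le_abs_descPochhammer (n + 1))
  have hw : |v a| * (Real.sqrt (Real.tanh dpt) * K ^ (-(1 / 2) : ℝ))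
      ≤ |v a * ampF dpt (J a) * (κ + shiftF dpt g γ (J a)) ^ (-(1 / 2) : ℝ)| := by
    have h3 : K ^ (-(1 / 2) : ℝ) ≤ (κ + shiftF dpt g γ (J a)) ^ (-(1 / 2) : ℝ) :=
      Real.rpow_le_rpow_of_nonpos (hpos a) (hle a) (by norm_num)
    have h4 := sqrt_tanh_le_ampF hdpt (hJ a)
    have h5 : 0 ≤ ampF dpt (J a) := Real.sqrt_nonneg _
    rw [abs_mul, abs_mul, abs_of_nonneg h5, abs_of_pos (Real.rpow_pos_of_pos (hpos a) _),
      mul_assoc]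
    gcongr
  calc _ = (1 / 2) ^ (N + 1) * (|v a| * (Real.sqrt (Real.tanh dpt) * K ^ (-(1 / 2) : ℝ))
        * (δ / (1 + κ₁⁻¹)) ^ N) := by ring
    _ ≤ _ := by
      refine mul_le_mul hb (le_trans ?_ hbound) (by positivity) (abs_nonneg _)
      exact mul_le_mul_of_nonneg_right hw (by positivity)

lemma exists_norm_le_abs_apply {ν : ℕ} (hν : 1 ≤ ν) (ℓ : Fin ν → ℤ) :
    ∃ a, ‖ℓ‖ ≤ |(ℓ a : ℝ)| := by
  obtain ⟨a, -, ha⟩ := Finset.exists_max_image Finset.univ (fun i => |(ℓ i : ℝ)|)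
    ⟨⟨0, hν⟩, Finset.mem_univ _⟩
  refine ⟨a, (pi_norm_le_iff_of_nonneg (abs_nonneg _)).2 fun i => ?_⟩
  rw [Int.norm_eq_abs]
  exact ha i (Finset.mem_univ i)


/-- Transversality, first Melnikov conditions (with momentum condition). -/
theorem transversality_1st_Melnikov
    (dpt g γ κ₁ κ₂ : ℝ) (hdpt : 0 < dpt) (hg : 0 < g) (hκ₁ : 0 < κ₁) (hκ₁₂ : κ₁ < κ₂)
    (ν : ℕ) (hν : 1 ≤ ν) (jbar : Fin ν → ℤ)
    (hjne : ∀ a, jbar a ≠ 0)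
    (hjinj : Function.Injective fun a => |jbar a|) :
    ∃ m₀ : ℕ, ∃ ρ₀ > (0 : ℝ), ∀ κ ∈ Set.Icc κ₁ κ₂, ∀ ℓ : Fin ν → ℤ, ∀ j : ℤ,
      j ≠ 0 → (∀ a, j ≠ jbar a) → (∑ a, jbar a * ℓ a) + j = 0 →
      ∃ n ≤ m₀, ρ₀ * max 1 ‖ℓ‖ ≤
        |iteratedDeriv n
          (fun κ' => (∑ a, (ℓ a : ℝ) * OmegaF dpt g γ (jbar a) κ') + OmegaF dpt g γ j κ') κ| := by
  obtain ⟨B, hB1, hB⟩ : ∃ B : ℝ, 1 ≤ B ∧ ∀ a, |(jbar a : ℝ)| ≤ B := by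
    refine ⟨1 + ∑ a, |(jbar a : ℝ)|, ?_, fun a => ?_⟩
    · have := Finset.sum_nonneg fun a (_ : a ∈ Finset.univ) => abs_nonneg (jbar a : ℝ)
      linarith
    · have := Finset.single_le_sum (fun a _ => abs_nonneg (jbar a : ℝ)) (Finset.mem_univ a)
      linarith
  obtain ⟨ρ, hρ, H⟩ := exists_transversality_const γ hdpt hg hκ₁ hκ₁₂ ν hB1
  refine ⟨ν + 1, ρ / 2, by positivity, ?_⟩
  intro κ hκ ℓ j hj hjS hmom
  have hbound : ∀ x : ℝ, 1 ≤ x → ‖ℓ‖ ≤ x + 1 → ρ / 2 * max 1 ‖ℓ‖ ≤ ρ * x := by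
    intro x h1 h2
    have : max 1 ‖ℓ‖ ≤ 2 * x := max_le (by linarith) (by linarith)
    nlinarith
  have hone : ∀ (ℓ' : Fin ν → ℤ) (a : Fin ν), ℓ' ≠ 0 → ‖ℓ'‖ ≤ |(ℓ' a : ℝ)| →
      (1 : ℝ) ≤ |(ℓ' a : ℝ)| := by
    intro ℓ' a hne ha
    refine one_le_abs_cast fun h0 => hne ?_
    rw [h0] at ha
    simpa using ha
  by_cases hcase : ∃ a, |j| = |jbar a|
  · obtain ⟨a, ha⟩ := hcase
    have hja : j = -jbar a := (abs_eq_abs.1 ha).resolve_left (hjS a)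
    set ℓ' : Fin ν → ℤ := ℓ + Pi.single a 1 with hℓ'
    have hne : ℓ' ≠ 0 := by
      intro h0
      have h1 : ∑ b, jbar b * ℓ' b = 0 := by simp [h0]
      simp only [hℓ', Pi.add_apply, mul_add, Finset.sum_add_distrib, Pi.single_apply, mul_ite,
        mul_one, mul_zero, Finset.sum_ite_eq', Finset.mem_univ, if_true] at h1
      have := hjne a
      omega
    obtain ⟨b, hb⟩ := exists_norm_le_abs_apply hν ℓ'
    have hnorm : ‖ℓ‖ ≤ |(ℓ' b : ℝ)| + 1 := by
      have h1 : ‖(Pi.single a 1 : Fin ν → ℤ)‖ ≤ 1 := by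
        refine (pi_norm_le_iff_of_nonneg zero_le_one).2 fun i => ?_
        by_cases hi : i = a
        · subst hi
          simp
        · simp [hi]
      have h2 : ℓ = ℓ' - Pi.single a 1 := by simp [hℓ']
      calc ‖ℓ‖ = ‖ℓ' - Pi.single a 1‖ := by rw [← h2]
        _ ≤ ‖ℓ'‖ + ‖(Pi.single a 1 : Fin ν → ℤ)‖ := norm_sub_le _ _
        _ ≤ _ := add_le_add hb h1
    obtain ⟨n, hn, h⟩ := H (Fin ν) (by simp) jbar (fun i => (ℓ' i : ℝ))
      (γ / 2 * Gfun dpt (-jbar a) / ((-jbar a : ℤ) : ℝ) - γ / 2 * Gfun dpt (jbar a) / (jbar a : ℝ))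
      b hjne (hB b) (fun i hi hab => hi (hjinj hab).symm) κ hκ
    refine ⟨n, hn, (hbound _ (hone ℓ' b hne hb) hnorm).trans (h.trans_eq ?_)⟩
    congr 2
    funext κ'
    have h3 : ∑ i, (ℓ' i : ℝ) * OmegaF dpt g γ (jbar i) κ'
        = (∑ i, (ℓ i : ℝ) * OmegaF dpt g γ (jbar i) κ') + OmegaF dpt g γ (jbar a) κ' := by
      simp [hℓ', add_mul, Finset.sum_add_distrib, Pi.single_apply]
    rw [h3, hja]
    simp only [OmegaF, omegaF_neg]
    ring
  · push Not at hcase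
    have hne : ℓ ≠ 0 := by
      rintro rfl
      simp at hmom
      exact hj hmom
    obtain ⟨a, ha⟩ := exists_norm_le_abs_apply hν ℓ
    obtain ⟨n, hn, h⟩ := H (Option (Fin ν)) (by simp) (fun o => o.elim j jbar)
      (fun o => o.elim 1 fun i => (ℓ i : ℝ)) 0 (some a)
      (by rintro (_ | i); exacts [hj, hjne i]) (hB a)
      (by
        rintro (_ | i) hi
        · exact (hcase a).symm
        · exact fun hab => hi (congrArg some (hjinj hab).symm)) κ hκ
    refine ⟨n, hn, (hbound _ (hone ℓ a hne ha) (by linarith)).trans (h.trans_eq ?_)⟩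
    congr 2
    funext κ'
    simp [Fintype.sum_option, add_comm]
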